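/- Let G = G₁ ∗_C G₂ be a non-abelian limit group where G₁ and G₂ are finitely generated free groups and C is infinite cyclic or trivial. If U is a normal subgroup of G of prime index p, then rk_Q(U) > d(G); in particular d(U) > d(G). -/

import Mathlib

open scoped TensorProduct

/-- A group is fully residually free if every finite subset is mapped injectively
by some homomorphism to a free group. -/
def FullyResiduallyFree (G : Type*) [Group G] : Prop :=
  ∀ T : Finset G, ∃ (α : Type) (f : G →* FreeGroup α), Set.InjOn f T

/-- The rational rank `rk_Q(G) = dim_Q (G^ab ⊗_Z Q)`. -/
noncomputable def rkQ (G : Type*) [Group G] : ℕ :=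
  Module.finrank ℚ (ℚ ⊗[ℤ] Additive (Abelianization G))

/-- The minimal number of generators of a group. -/
noncomputable def d (G : Type*) [Group G] : ℕ :=
  sInf {n | ∃ S : Finset G, S.card = n ∧ Subgroup.closure (S : Set G) = ⊤}
/-- The amalgamated free product `G₁ ∗_H G₂` along `f₁ : H →* G₁`, `f₂ : H →* G₂`. -/
def AmalgamatedProduct {G₁ G₂ H : Type*} [Group G₁] [Group G₂] [Group H]
    (f₁ : H →* G₁) (f₂ : H →* G₂) : Type _ :=
  Monoid.Coprod G₁ G₂ ⧸ Subgroup.normalClosure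
    (Set.range fun h => Monoid.Coprod.inl (f₁ h) * (Monoid.Coprod.inr (f₂ h))⁻¹)

instance {G₁ G₂ H : Type*} [Group G₁] [Group G₂] [Group H]
    (f₁ : H →* G₁) (f₂ : H →* G₂) : Group (AmalgamatedProduct f₁ f₂) :=
  QuotientGroup.Quotient.group _

/-- The canonical map `G₁ →* G₁ ∗_H G₂`. -/
def AmalgamatedProduct.inl {G₁ G₂ H : Type*} [Group G₁] [Group G₂] [Group H]
    (f₁ : H →* G₁) (f₂ : H →* G₂) : G₁ →* AmalgamatedProduct f₁ f₂ :=
  (QuotientGroup.mk' _).comp Monoid.Coprod.inl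

/-- The canonical map `G₂ →* G₁ ∗_H G₂`. -/
def AmalgamatedProduct.inr {G₁ G₂ H : Type*} [Group G₁] [Group G₂] [Group H]
    (f₁ : H →* G₁) (f₂ : H →* G₂) : G₂ →* AmalgamatedProduct f₁ f₂ :=
  (QuotientGroup.mk' _).comp Monoid.Coprod.inr

theorem ring_e1 {A : Type*} [Ring A] (x y : A) :
    x * y - 1 = (x - 1) * (y - 1) + (x - 1) + (y - 1) := by
  simp only [mul_sub, sub_mul, mul_one, one_mul]; abel

theorem ring_e2 {A : Type*} [Ring A] (k' g k : A) (h : k' * g = g * k) :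
    (k' - 1) + (k' - 1) * (g - 1) = (k - 1) + (g - 1) * (k - 1) := by
  simp only [mul_sub, sub_mul, mul_one, one_mul, h]; abel

def PF (j : ℕ) (T : Module.End ℚ (ℕ → ℚ)) : Prop :=
  ∀ (i : ℕ) (v : ℕ → ℚ), (∀ a < i, v a = 0) → ∀ a < i + j, T v a = 0

open Classical in
noncomputable def Nop {ι : Type*} (idx : ℕ → Option ι) (i : ι) : Module.End ℚ (ℕ → ℚ) where
  toFun v := fun b => match b with
    | 0 => 0
    | b + 1 => if idx b = some i then v b else 0
  map_add' u v := by
    funext b; cases b <;> simp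
    split_ifs <;> simp
  map_smul' u v := by
    funext b; cases b <;> simp

theorem Nop_sq {ι : Type*} (idx : ℕ → Option ι) (i : ι)
    (h : ∀ b, idx b = some i → idx (b+1) ≠ some i) : Nop idx i * Nop idx i = 0 := by
  ext v b
  rcases b with _ | _ | b
  · simp [Nop]
  · simp [Nop]
  · have := h b
    simp only [Nop, Module.End.mul_apply, LinearMap.coe_mk, AddHom.coe_mk]
    split_ifs <;> simp_all

noncomputable def Nhom {ι : Type*} (idx : ℕ → Option ι) (i : ι)
    (h : ∀ b, idx b = some i → idx (b+1) ≠ some i) :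
    Multiplicative ℤ →* Module.End ℚ (ℕ → ℚ) where
  toFun e := 1 + (e.toAdd : ℚ) • Nop idx i
  map_one' := by simp
  map_mul' a b := by
    have := Nop_sq idx i h
    simp only [toAdd_mul, Int.cast_add, add_mul, mul_add, smul_mul_smul_comm, this]
    simp
    module

theorem freeGroup_unip {α : Type*} (w : FreeGroup α) (hw : w ≠ 1) :
    ∃ ρ : FreeGroup α →* Module.End ℚ (ℕ → ℚ), ρ w ≠ 1 ∧ ∀ g, PF 1 (ρ g - 1) := by
  classical
  let W := Monoid.CoprodI.Word.equiv (freeGroupEquivCoprodI w)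
  have hWprod : W.prod = freeGroupEquivCoprodI w := Monoid.CoprodI.Word.equiv.symm_apply_apply _
  let idx : ℕ → Option α := fun b => (W.toList.reverse[b]?).map Sigma.fst
  have hidx : ∀ i b, idx b = some i → idx (b+1) ≠ some i := by
    intro i b h1 h2
    have hc : W.toList.reverse.IsChain (fun l l' => Sigma.fst l' ≠ Sigma.fst l) := by
      rw [List.isChain_reverse]; exact W.chain_ne
    simp only [idx, Option.map_eq_some_iff] at h1 h2
    obtain ⟨s, hs, rfl⟩ := h1
    obtain ⟨t, ht, hst⟩ := h2
    rw [List.getElem?_eq_some_iff] at hs ht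
    obtain ⟨hs1, hs2⟩ := hs
    obtain ⟨ht1, ht2⟩ := ht
    have := List.isChain_iff_getElem.mp hc b (by omega)
    rw [hs2, ht2] at this
    exact this hst
  let E : FreeGroup Unit ≃* Multiplicative ℤ := FreeGroup.mulEquivIntOfUnique
  let ρ' : Monoid.CoprodI (fun _ : α => FreeGroup Unit) →* Module.End ℚ (ℕ → ℚ) :=
    Monoid.CoprodI.lift (fun i => (Nhom idx i (hidx i)).comp E.toMonoidHom)
  refine ⟨ρ'.comp freeGroupEquivCoprodI.toMonoidHom, ?_, ?_⟩
  · intro h1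
    have h2 : ρ' W.prod = 1 := by rw [hWprod]; exact h1
    have key : ∀ (l pre : List (Σ _ : α, FreeGroup Unit)), W.toList = pre ++ l →
        (∀ b, l.length < b → ((l.map fun s => ρ' (Monoid.CoprodI.of (i := s.1) s.2)).prod
          (Pi.single 0 1 : ℕ → ℚ)) b = 0) ∧ ((l.map fun s => ρ' (Monoid.CoprodI.of (i := s.1) s.2)).prod
          (Pi.single 0 1 : ℕ → ℚ)) l.length ≠ 0 := by
      intro l
      induction l with
      | nil =>
        intro pre _
        constructor
        · intro b hb
          simp at hb
          simp [Pi.single_apply, hb.ne']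
        · simp
      | cons s l ih =>
        intro pre hpre
        obtain ⟨ih1, ih2⟩ := ih (pre ++ [s]) (by simp [hpre])
        have hne : s.2 ≠ 1 := W.ne_one s (by simp [hpre])
        have hE : (E s.2).toAdd ≠ 0 := by
          intro h; apply hne
          apply E.injective
          rw [map_one]; exact h
        have hix : idx l.length = some s.1 := by
          simp [idx, hpre]
        have hρ : ρ' (Monoid.CoprodI.of (i := s.1) s.2) = 1 + ((E s.2).toAdd : ℚ) • Nop idx s.1 := by
          simp only [ρ', Monoid.CoprodI.lift_of]; rfl
        rw [List.map_cons, List.prod_cons, hρ]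
        set v := (l.map fun s => ρ' (Monoid.CoprodI.of (i := s.1) s.2)).prod (Pi.single 0 1 : ℕ → ℚ)
        constructor
        · intro b hb
          rcases b with _ | b
          · simp at hb
          · simp at hb
            have a1 := ih1 (b+1) (by omega)
            have a2 := ih1 b (by omega)
            simp [Nop, Module.End.mul_apply, v, a1, a2] 
        · have a1 := ih1 (l.length+1) (by omega)
          simp only [List.length_cons, Module.End.mul_apply, LinearMap.add_apply, Pi.add_apply,
            Module.End.one_apply, LinearMap.smul_apply, Pi.smul_apply]
          change v (l.length + 1) + _ • (Nop idx s.1) v (l.length + 1) ≠ 0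
          rw [a1]
          simp only [Nop, LinearMap.coe_mk, AddHom.coe_mk, hix, if_true, zero_add, smul_eq_mul]
          exact mul_ne_zero (by exact_mod_cast hE) ih2
    have hk := key W.toList [] (by simp)
    have h3 : (W.toList.map fun s => ρ' (Monoid.CoprodI.of (i := s.1) s.2)).prod = 1 := by
      rw [← h2, Monoid.CoprodI.Word.prod, map_list_prod, List.map_map]; rfl
    rw [h3] at hk
    have hl : W.toList.length = 0 := by
      by_contra hl
      apply hk.2
      simp [Pi.single_apply, hl]
    have : W.toList = [] := List.length_eq_zero_iff.mp hl
    apply hw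
    apply freeGroupEquivCoprodI.injective
    rw [← hWprod, Monoid.CoprodI.Word.prod, this]
    simp
  · intro g
    show PF 1 (ρ' (freeGroupEquivCoprodI g) - 1)
    generalize freeGroupEquivCoprodI g = x
    induction x using Monoid.CoprodI.induction_on with
    | one => intro i v _ a _; simp
    | of i m =>
      have hρ : ρ' (Monoid.CoprodI.of (i := i) m) = 1 + ((E m).toAdd : ℚ) • Nop idx i := by
          simp only [ρ', Monoid.CoprodI.lift_of]; rfl
      rw [hρ]
      intro k v hv a ha
      rcases a with _ | a
      · simp [Nop]
      · simp [Nop]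
        intro _; right; exact hv a (by omega)
    | mul x y hx hy =>
      intro k v hv a ha
      have e : ρ' (x * y) - 1 = (ρ' x - 1) * (ρ' y - 1) + (ρ' x - 1) + (ρ' y - 1) := by
        rw [map_mul]; exact ring_e1 _ _
      rw [e]
      simp only [LinearMap.add_apply, Pi.add_apply, Module.End.mul_apply]
      rw [hx k v hv a ha, hy k v hv a ha, hx (k+1) _ (hy k v hv) a (by omega)]
      simp
/-- additive functions to ℚ -/
def HomQ (G : Type*) [Group G] : Submodule ℚ (G → ℚ) where
  carrier := {φ | ∀ g h, φ (g * h) = φ g + φ h}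
  add_mem' {a b} ha hb g h := by simp only [Pi.add_apply, ha g h, hb g h]; ring
  zero_mem' := by simp
  smul_mem' c a ha g h := by simp [ha g h, mul_add]

theorem HomQ_one {G : Type*} [Group G] (φ : HomQ G) : φ.1 1 = 0 := by
  have := φ.2 1 1
  simpa using this

theorem HomQ_mul {G : Type*} [Group G] (φ : HomQ G) (g h : G) :
    φ.1 (g * h) = φ.1 g + φ.1 h := φ.2 g h

theorem HomQ_inv {G : Type*} [Group G] (φ : HomQ G) (g : G) : φ.1 g⁻¹ = - φ.1 g := by
  have := φ.2 g g⁻¹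
  rw [mul_inv_cancel, HomQ_one] at this
  linarith

def HomQ.toHom {G : Type*} [Group G] (φ : HomQ G) : G →* Multiplicative ℚ where
  toFun g := Multiplicative.ofAdd (φ.1 g)
  map_one' := by rw [HomQ_one]; rfl
  map_mul' g h := by rw [HomQ_mul]; rfl

theorem HomQ_ext_closure {G : Type*} [Group G] (S : Set G) (hS : Subgroup.closure S = ⊤)
    (φ : HomQ G) (h : ∀ s ∈ S, φ.1 s = 0) : φ = 0 := by
  ext g
  have hg : g ∈ Subgroup.closure S := by rw [hS]; trivial
  induction hg using Subgroup.closure_induction with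
  | mem x hx => exact h x hx
  | one => exact HomQ_one φ
  | mul x y _ _ hx hy =>
    rw [HomQ_mul, hx, hy]; simp
  | inv x _ hx => rw [HomQ_inv, hx]; simp

def HomQ.comap {G L : Type*} [Group G] [Group L] (f : L →* G) : HomQ G →ₗ[ℚ] HomQ L where
  toFun φ := ⟨fun g => φ.1 (f g), fun g h => by simp only [map_mul, HomQ_mul]⟩
  map_add' _ _ := rfl
  map_smul' _ _ := rfl

noncomputable def HomQ.equiv (G : Type*) [Group G] :
    HomQ G ≃ₗ[ℚ] (Additive (Abelianization G) →ₗ[ℤ] ℚ) where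
  toFun φ := (MonoidHom.toAdditiveLeft (Abelianization.lift (HomQ.toHom φ))).toIntLinearMap
  map_add' φ ψ := by
    ext x
    obtain ⟨x, rfl⟩ := Additive.ofMul.surjective x
    obtain ⟨x, rfl⟩ := QuotientGroup.mk_surjective x
    rfl
  map_smul' c φ := by
    ext x
    obtain ⟨x, rfl⟩ := Additive.ofMul.surjective x
    obtain ⟨x, rfl⟩ := QuotientGroup.mk_surjective x
    rfl
  invFun f := ⟨fun g => f (Additive.ofMul (Abelianization.of g)), fun g h => by simp⟩
  left_inv φ := rfl
  right_inv f := by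
    ext x
    obtain ⟨x, rfl⟩ := Additive.ofMul.surjective x
    obtain ⟨x, rfl⟩ := QuotientGroup.mk_surjective x
    rfl

theorem rkQ_eq (G : Type*) [Group G] : rkQ G = Module.finrank ℚ (HomQ G) := by
  rw [rkQ, ← Subspace.dual_finrank_eq]
  exact (LinearEquiv.finrank_eq ((HomQ.equiv G).trans (LinearMap.liftBaseChangeEquiv ℚ))).symm

def HomQ.eval {G : Type*} [Group G] {ι : Type*} (s : ι → G) : HomQ G →ₗ[ℚ] (ι → ℚ) where
  toFun φ i := φ.1 (s i)
  map_add' _ _ := rfl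
  map_smul' _ _ := rfl

theorem HomQ.eval_inj {G : Type*} [Group G] {ι : Type*} (s : ι → G)
    (hs : Subgroup.closure (Set.range s) = ⊤) : Function.Injective (HomQ.eval s) := by
  rw [injective_iff_map_eq_zero]
  intro φ h
  apply HomQ_ext_closure _ hs
  rintro _ ⟨i, rfl⟩
  exact congrFun h i

theorem HomQ.finite {G : Type*} [Group G] [Group.FG G] : Module.Finite ℚ (HomQ G) := by
  obtain ⟨S, hS⟩ := Group.fg_def.mp (inferInstance : Group.FG G)
  exact Module.Finite.of_injective (HomQ.eval ((↑) : S → G))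
    (HomQ.eval_inj _ (by simpa using hS))

theorem d_le {G : Type*} [Group G] {ι : Type*} [Fintype ι] (s : ι → G)
    (hs : Subgroup.closure (Set.range s) = ⊤) : d G ≤ Fintype.card ι := by
  classical
  have h : d G ≤ (Finset.univ.image s).card := Nat.sInf_le ⟨_, rfl, by simpa using hs⟩
  exact h.trans Finset.card_image_le

theorem rkQ_le_d {G : Type*} [Group G] [Group.FG G] : rkQ G ≤ d G := by
  have hne : {n | ∃ S : Finset G, S.card = n ∧ Subgroup.closure (S : Set G) = ⊤}.Nonempty := by
    obtain ⟨S, hS⟩ := Group.fg_def.mp (inferInstance : Group.FG G)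
    exact ⟨_, S, rfl, hS⟩
  obtain ⟨S, hc, hS⟩ := Nat.sInf_mem hne
  rw [d, ← hc, rkQ_eq]
  refine (LinearMap.finrank_le_finrank_of_injective
    (HomQ.eval_inj ((↑) : S → G) (by simpa using hS))).trans ?_
  simp

theorem HomQ_inv_zero {G L : Type*} [Group G] [Group L] (f : G →* L) (s : L →* G)
    (hfs : ∀ l, f (s l) = l) (hsurj : Function.Surjective (HomQ.comap f))
    (φ : G → ℚ) (hmul : ∀ k k', f k = 1 → f k' = 1 → φ (k * k') = φ k + φ k')
    (hinv : ∀ g k, f k = 1 → φ (g * k * g⁻¹) = φ k) : ∀ k, f k = 1 → φ k = 0 := by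
  have h1 : φ 1 = 0 := by simpa using hmul 1 1 (map_one f) (map_one f)
  let Φ : HomQ G := ⟨fun g => φ (g * (s (f g))⁻¹), by
    intro g h
    have e : g * h * (s (f (g * h)))⁻¹ =
        (g * (h * (s (f h))⁻¹) * g⁻¹) * (g * (s (f g))⁻¹) := by
      simp only [map_mul]; group
    show φ _ = φ _ + φ _
    rw [e, hmul _ _ (by simp [hfs]) (by simp [hfs]), hinv _ _ (by simp [hfs])]
    ring⟩
  obtain ⟨ψ, hψ⟩ := hsurj Φ
  intro k hk
  have a1 : Φ.1 k = φ k := by simp [Φ, hk]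
  rw [← a1, ← hψ]
  show ψ.1 (f k) = 0
  rw [hk, HomQ_one]

theorem unip_kills {G L : Type*} [Group G] [Group L] (f : G →* L) (s : L →* G)
    (hfs : ∀ l, f (s l) = l) (hsurj : Function.Surjective (HomQ.comap f))
    (ρ : G →* Module.End ℚ (ℕ → ℚ)) (hρ : ∀ g, PF 1 (ρ g - 1)) (k : G) (hk : f k = 1) :
    ρ k = 1 := by
  have key : ∀ j, 1 ≤ j → ∀ k, f k = 1 → PF j (ρ k - 1) := by
    intro j hj
    induction j, hj using Nat.le_induction with
    | base => exact fun k _ => hρ k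
    | succ j hj ih =>
      intro k hk i v hv a ha
      rcases Nat.lt_or_ge a (i + j) with h | h
      · exact ih k hk i v hv a h
      obtain rfl : a = i + j := by omega
      refine HomQ_inv_zero f s hfs hsurj (fun k => ((ρ k - 1) v) (i + j)) ?_ ?_ k hk
      · intro k k' hk hk'
        have e : ρ (k * k') - 1 = (ρ k - 1) * (ρ k' - 1) + (ρ k - 1) + (ρ k' - 1) := by
          rw [map_mul]; exact ring_e1 _ _
        have z := ih k hk (i + j) _ (ih k' hk' i v hv) (i + j) (by omega)
        simp only [e, LinearMap.add_apply, Pi.add_apply, Module.End.mul_apply, z]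
        ring
      · intro g k hk
        have hk' : f (g * k * g⁻¹) = 1 := by simp [hk]
        have e : (ρ (g * k * g⁻¹) - 1) + (ρ (g * k * g⁻¹) - 1) * (ρ g - 1)
            = (ρ k - 1) + (ρ g - 1) * (ρ k - 1) := by
          have : ρ (g * k * g⁻¹) * ρ g = ρ g * ρ k := by
            rw [← map_mul, ← map_mul]; simp
          exact ring_e2 _ _ _ this
        have e3 := congrFun (congrArg (fun T => T v) e) (i + j)
        simp only [LinearMap.add_apply, Pi.add_apply, Module.End.mul_apply] at e3
        rw [ih _ hk' (i + 1) _ (hρ g i v hv) (i + j) (by omega),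
          hρ g (i + j) _ (ih k hk i v hv) (i + j) (by omega)] at e3
        simpa using e3
  have : ρ k - 1 = 0 := by
    refine LinearMap.ext fun v => funext fun a => ?_
    exact key (a + 1) (by omega) k hk 0 v (by simp) a (by omega)
  exact sub_eq_zero.mp this

/-- universal property evaluation for free groups -/
theorem HomQ.eval_surj_free (ι : Type*) :
    Function.Surjective (HomQ.eval (FreeGroup.of : ι → FreeGroup ι)) := by
  intro v
  let h : FreeGroup ι →* Multiplicative ℚ := FreeGroup.lift fun i => Multiplicative.ofAdd (v i)
  refine ⟨⟨fun g => (h g).toAdd, fun a b => by simp⟩, ?_⟩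
  funext i
  simp [HomQ.eval, h]

theorem limit_small {G : Type*} [Group G] (hlim : FullyResiduallyFree G)
    (hna : ¬ ∀ a b : G, a * b = b * a) (r : ℕ)
    (ev : HomQ G →ₗ[ℚ] (Fin r → ℚ)) (hev : Function.Injective ev) :
    2 ≤ r ∧ (r = 2 → d G ≤ 2) := by
  classical
  push Not at hna
  obtain ⟨a, b, hab⟩ := hna
  obtain ⟨α, f, hf⟩ := hlim {a * b, b * a}
  have hfab : f (a * b) ≠ f (b * a) := fun h => hab (hf (by simp) (by simp) h)
  let e := IsFreeGroup.toFreeGroup f.range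
  set ι := IsFreeGroup.Generators f.range
  let F : G →* FreeGroup ι := e.toMonoidHom.comp f.rangeRestrict
  have hFs : Function.Surjective F := e.surjective.comp f.rangeRestrict_surjective
  have hFab : F (a * b) ≠ F (b * a) := by
    intro h
    apply hfab
    exact congrArg Subtype.val (e.injective h)
  have hnt : Nontrivial ι := by
    by_contra hn
    rw [not_nontrivial_iff_subsingleton] at hn
    apply hFab
    rw [map_mul, map_mul]
    rcases isEmpty_or_nonempty ι with hi | ⟨⟨i⟩⟩
    · exact Subsingleton.elim _ _
    · let _ : Unique ι := ⟨⟨i⟩, fun _ => Subsingleton.elim _ _⟩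
      apply (FreeGroup.mulEquivIntOfUnique (α := ι)).injective
      rw [map_mul, map_mul, mul_comm]
  choose t ht using fun i : ι => hFs (FreeGroup.of i)
  let s : FreeGroup ι →* G := FreeGroup.lift t
  have hFs' : ∀ l, F (s l) = l := by
    intro l
    have : F.comp s = MonoidHom.id _ := by
      ext i; simp [s, ht]
    exact DFunLike.congr_fun this l
  have hcinj : Function.Injective (HomQ.comap F) := by
    rw [injective_iff_map_eq_zero]
    intro φ h
    ext l
    obtain ⟨g, rfl⟩ := hFs l
    exact congrFun (congrArg Subtype.val h) g
  have : Module.Finite ℚ (HomQ G) := Module.Finite.of_injective ev hev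
  have : Module.Finite ℚ (HomQ (FreeGroup ι)) := Module.Finite.of_injective _ hcinj
  have hG : Module.finrank ℚ (HomQ G) ≤ r := by
    simpa using LinearMap.finrank_le_finrank_of_injective hev
  have hL := LinearMap.finrank_le_finrank_of_injective hcinj
  let E : HomQ (FreeGroup ι) ≃ₗ[ℚ] (ι → ℚ) := LinearEquiv.ofBijective _
    ⟨HomQ.eval_inj _ (FreeGroup.closure_range_of ι), HomQ.eval_surj_free ι⟩
  have : Module.Finite ℚ (ι → ℚ) := Module.Finite.equiv E
  have : Finite ι := by
    have li := Pi.linearIndependent_single_one ι ℚ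
    exact li.finite
  have : Fintype ι := Fintype.ofFinite ι
  have hc : Module.finrank ℚ (HomQ (FreeGroup ι)) = Fintype.card ι := by
    rw [E.finrank_eq]; simp
  have hc2 : 2 ≤ Fintype.card ι := Fintype.one_lt_card
  refine ⟨by omega, fun hr => ?_⟩
  have hsur : Function.Surjective (HomQ.comap F) :=
    (LinearMap.injective_iff_surjective_of_finrank_eq_finrank (by omega)).mp hcinj
  have hinj : ∀ k, F k = 1 → k = 1 := by
    intro k hk
    by_contra hk1
    obtain ⟨β, h, hh⟩ := hlim {k, 1}
    have hk2 : h k ≠ 1 := by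
      intro h'
      exact hk1 (hh (by simp) (by simp) (by rw [h', map_one]))
    obtain ⟨ρ, h1, h2⟩ := freeGroup_unip (h k) hk2
    exact h1 (unip_kills F s hFs' hsur (ρ.comp h) (fun g => h2 _) k hk)
  have hcl : Subgroup.closure (Set.range t) = ⊤ := by
    rw [← FreeGroup.range_lift_eq_closure, eq_top_iff]
    intro g _
    refine ⟨F g, ?_⟩
    have : F (s (F g) * g⁻¹) = 1 := by simp [hFs']
    exact mul_inv_eq_one.mp (hinj _ this)
  exact (d_le t hcl).trans (by omega)

/-- rational cocycles for a permutation action -/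
def Coc {Γ X : Type*} [Group Γ] (π : Γ →* Equiv.Perm X) : Submodule ℚ (Γ → X → ℚ) where
  carrier := {c | ∀ g h x, c (g * h) x = c g (π h x) + c h x}
  add_mem' {a b} ha hb g h x := by simp only [Pi.add_apply, ha g h, hb g h]; ring
  zero_mem' := by simp
  smul_mem' c a ha g h x := by simp [ha g h, mul_add]

theorem Coc_one {Γ X : Type*} [Group Γ] {π : Γ →* Equiv.Perm X} (c : Coc π) (x : X) :
    c.1 1 x = 0 := by
  have := c.2 1 1 x
  simpa using this

def Coc.perm {Γ X : Type*} [Group Γ] {π : Γ →* Equiv.Perm X} (c : Coc π) :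
    Γ →* Equiv.Perm (X × ℚ) where
  toFun g :=
    { toFun := fun y => (π g y.1, y.2 + c.1 g y.1)
      invFun := fun y => (π g⁻¹ y.1, y.2 + c.1 g⁻¹ y.1)
      left_inv := fun ⟨x, q⟩ => by
        have h := c.2 g⁻¹ g x
        rw [inv_mul_cancel, Coc_one] at h
        ext
        · simp
        · show q + c.1 g x + c.1 g⁻¹ (π g x) = q
          linarith
      right_inv := fun ⟨x, q⟩ => by
        have h := c.2 g g⁻¹ x
        rw [mul_inv_cancel, Coc_one] at h
        ext
        · simp
        · show q + c.1 g⁻¹ x + c.1 g (π g⁻¹ x) = q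
          linarith }
  map_one' := by
    ext ⟨x, q⟩
    · simp
    · simp [Coc_one]
  map_mul' g h := by
    ext ⟨x, q⟩
    · simp
    · have := c.2 g h x
      simp only [Equiv.coe_fn_mk, Equiv.Perm.coe_mul, Function.comp_apply, this]
      ring

theorem Coc_of_perm {Γ X : Type*} [Group Γ] (π : Γ →* Equiv.Perm X)
    (σ : Γ →* Equiv.Perm (X × ℚ)) (S : Set Γ) (hS : Subgroup.closure S = ⊤)
    (h : ∀ s ∈ S, ∃ v : X → ℚ, ∀ x q, σ s (x, q) = (π s x, q + v x)) :
    ∃ c : Coc π, ∀ g x q, σ g (x, q) = (π g x, q + c.1 g x) := by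
  have key : ∀ g, ∃ v : X → ℚ, ∀ x q, σ g (x, q) = (π g x, q + v x) := by
    intro g
    have hg : g ∈ Subgroup.closure S := by rw [hS]; trivial
    induction hg using Subgroup.closure_induction with
    | mem x hx => exact h x hx
    | one => exact ⟨0, fun x q => by simp⟩
    | mul a b _ _ ha hb =>
      obtain ⟨v, hv⟩ := ha
      obtain ⟨w, hw⟩ := hb
      refine ⟨fun x => w x + v (π b x), fun x q => ?_⟩
      rw [map_mul, Equiv.Perm.mul_apply, hw, hv, map_mul, Equiv.Perm.mul_apply, add_assoc]
    | inv a _ ha =>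
      obtain ⟨v, hv⟩ := ha
      refine ⟨fun x => - v (π a⁻¹ x), fun x q => ?_⟩
      rw [map_inv, Equiv.Perm.inv_eq_iff_eq, hv]
      simp
  choose c hc using key
  refine ⟨⟨c, fun g h x => ?_⟩, hc⟩
  have e := hc (g * h) x 0
  rw [map_mul, Equiv.Perm.mul_apply, hc, hc] at e
  have := congrArg Prod.snd e
  simp at this
  linarith

theorem Coc_ext {Γ X : Type*} [Group Γ] {π : Γ →* Equiv.Perm X} (S : Set Γ)
    (hS : Subgroup.closure S = ⊤) (c : Coc π) (h : ∀ s ∈ S, ∀ x, c.1 s x = 0) : c = 0 := by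
  ext g x
  have hg : g ∈ Subgroup.closure S := by rw [hS]; trivial
  induction hg using Subgroup.closure_induction generalizing x with
  | mem y hy => exact h y hy _
  | one => exact Coc_one c x
  | mul a b _ _ ha hb =>
    have := c.2 a b x
    rw [this, ha, hb]; simp
  | inv a _ ha =>
    have := c.2 a a⁻¹ x
    rw [mul_inv_cancel, Coc_one, ha] at this
    simpa using this.symm

/-- labels of generators -/
def Coc.label {X ι : Type*} (π : FreeGroup ι →* Equiv.Perm X) : Coc π →ₗ[ℚ] (ι → X → ℚ) where
  toFun c i := c.1 (FreeGroup.of i)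
  map_add' _ _ := rfl
  map_smul' _ _ := rfl

theorem Coc.label_bij {X ι : Type*} (π : FreeGroup ι →* Equiv.Perm X) :
    Function.Bijective (Coc.label π) := by
  constructor
  · rw [injective_iff_map_eq_zero]
    intro c h
    apply Coc_ext _ (FreeGroup.closure_range_of ι)
    rintro _ ⟨i, rfl⟩ x
    exact congrFun (congrFun h i) x
  · intro v
    let σ : FreeGroup ι →* Equiv.Perm (X × ℚ) := FreeGroup.lift fun i =>
      { toFun := fun y => (π (FreeGroup.of i) y.1, y.2 + v i y.1)
        invFun := fun y => ((π (FreeGroup.of i)).symm y.1,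
          y.2 - v i ((π (FreeGroup.of i)).symm y.1))
        left_inv := fun ⟨x, q⟩ => by simp
        right_inv := fun ⟨x, q⟩ => by simp }
    obtain ⟨c, hc⟩ := Coc_of_perm π σ _ (FreeGroup.closure_range_of ι) (by
      rintro _ ⟨i, rfl⟩
      exact ⟨v i, fun x q => by simp [σ]⟩)
    refine ⟨c, ?_⟩
    funext i x
    have := hc (FreeGroup.of i) x 0
    simp [σ] at this
    exact this.symm

theorem Coc.finite_free {X : Type*} [Finite X] (k : ℕ) (π : FreeGroup (Fin k) →* Equiv.Perm X) :
    Module.Finite ℚ (Coc π) ∧ Module.finrank ℚ (Coc π) = k * Nat.card X := by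
  let E := LinearEquiv.ofBijective _ (Coc.label_bij π)
  have := Fintype.ofFinite X
  refine ⟨Module.Finite.equiv E.symm, ?_⟩
  rw [E.finrank_eq, Module.finrank_pi_fintype]
  simp

def Coc.comap {Γ Δ X : Type*} [Group Γ] [Group Δ] (j : Δ →* Γ) (π : Γ →* Equiv.Perm X) :
    Coc π →ₗ[ℚ] Coc (π.comp j) where
  toFun c := ⟨fun g => c.1 (j g), fun g h x => by
    have := c.2 (j g) (j h) x
    simpa using this⟩
  map_add' _ _ := rfl
  map_smul' _ _ := rfl

theorem Coc_le {G : Type*} [Group G] [Group.FG G] (U : Subgroup G) [Finite (G ⧸ U)] :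
    Module.Finite ℚ (Coc (MulAction.toPermHom G (G ⧸ U))) ∧
    Module.finrank ℚ (Coc (MulAction.toPermHom G (G ⧸ U))) + 1 ≤ rkQ U + Nat.card (G ⧸ U) := by
  classical
  have hUi : U.index ≠ 0 := by
    rw [Subgroup.index]; exact Nat.card_pos.ne'
  have : U.FiniteIndex := ⟨hUi⟩
  have : Group.FG U := inferInstance
  have := HomQ.finite (G := U)
  have := Fintype.ofFinite (G ⧸ U)
  let x0 : G ⧸ U := ((1 : G) : G ⧸ U)
  have hg0 : ∀ g : G, MulAction.toPermHom G (G ⧸ U) g x0 = (g : G ⧸ U) := by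
    intro g
    simp [x0, MulAction.Quotient.smul_coe]
  have hu0 : ∀ u : U, MulAction.toPermHom G (G ⧸ U) u x0 = x0 := by
    intro u
    rw [hg0]
    exact (QuotientGroup.eq.mpr (by simp)).symm
  let Ψ : Coc (MulAction.toPermHom G (G ⧸ U)) →ₗ[ℚ] HomQ U × ({x : G ⧸ U // x ≠ x0} → ℚ) :=
    { toFun := fun c => (⟨fun u => c.1 u x0, fun u v => by
        have := c.2 u v x0
        rw [hu0] at this
        exact this⟩, fun x => c.1 x.1.out x0)
      map_add' := fun _ _ => rfl
      map_smul' := fun _ _ => rfl }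
  have hΨ : Function.Injective Ψ := by
    rw [injective_iff_map_eq_zero]
    intro c hc
    have h1 : ∀ u : U, c.1 u x0 = 0 := fun u =>
      congrFun (congrArg Subtype.val (congrArg Prod.fst hc)) u
    have h2 : ∀ x : G ⧸ U, c.1 x.out x0 = 0 := by
      intro x
      by_cases hx : x = x0
      · have : x.out ∈ U := by
          have h := (QuotientGroup.eq (s := U) (a := 1) (b := x.out)).mp (by rw [QuotientGroup.out_eq']; exact hx.symm)
          simpa using h
        exact h1 ⟨_, this⟩
      · exact congrFun (congrArg Prod.snd hc) ⟨x, hx⟩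
    have h3 : ∀ g : G, c.1 g x0 = 0 := by
      intro g
      have hu : (g : G ⧸ U).out⁻¹ * g ∈ U := by
        rw [← QuotientGroup.eq]; simp
      have := c.2 (g : G ⧸ U).out ((g : G ⧸ U).out⁻¹ * g) x0
      rw [hu0 ⟨_, hu⟩, h2, h1 ⟨_, hu⟩, mul_inv_cancel_left] at this
      simpa using this
    ext g x
    obtain ⟨h, rfl⟩ := QuotientGroup.mk_surjective x
    have := c.2 g h x0
    rw [h3, h3, hg0] at this
    simpa using this.symm
  refine ⟨Module.Finite.of_injective Ψ hΨ, ?_⟩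
  have hle := LinearMap.finrank_le_finrank_of_injective hΨ
  rw [Module.finrank_prod, ← rkQ_eq, Module.finrank_fintype_fun_eq_card] at hle
  have hcard : Fintype.card {x : G ⧸ U // x ≠ x0} = Fintype.card (G ⧸ U) - 1 := by
    rw [Fintype.card_subtype_compl]; simp
  have : 0 < Fintype.card (G ⧸ U) := Fintype.card_pos_iff.mpr ⟨x0⟩
  rw [Nat.card_eq_fintype_card]
  omega

theorem amalg_closure {G₁ G₂ H : Type*} [Group G₁] [Group G₂] [Group H]
    (f₁ : H →* G₁) (f₂ : H →* G₂) :
    Subgroup.closure (Set.range (AmalgamatedProduct.inl f₁ f₂) ∪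
      Set.range (AmalgamatedProduct.inr f₁ f₂)) = ⊤ := by
  have h := Monoid.Coprod.closure_range_inl_union_inr (G := G₁) (H := G₂)
  have h2 := congrArg (Subgroup.map (QuotientGroup.mk' (Subgroup.normalClosure
    (Set.range fun h => Monoid.Coprod.inl (f₁ h) * (Monoid.Coprod.inr (f₂ h))⁻¹)))) h
  rw [MonoidHom.map_closure, Set.image_union, ← Set.range_comp, ← Set.range_comp,
    ← MonoidHom.range_eq_map, QuotientGroup.range_mk'] at h2
  exact h2

theorem amalg_rel {G₁ G₂ H : Type*} [Group G₁] [Group G₂] [Group H]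
    (f₁ : H →* G₁) (f₂ : H →* G₂) (h : H) :
    AmalgamatedProduct.inl f₁ f₂ (f₁ h) = AmalgamatedProduct.inr f₁ f₂ (f₂ h) := by
  rw [← mul_inv_eq_one, ← map_inv]
  refine (QuotientGroup.eq_one_iff (Monoid.Coprod.inl (f₁ h) * Monoid.Coprod.inr (f₂ h)⁻¹)).mpr ?_
  rw [map_inv]
  exact Subgroup.subset_normalClosure ⟨h, rfl⟩

theorem amalg_lift {G₁ G₂ H P : Type*} [Group G₁] [Group G₂] [Group H] [Group P]
    (f₁ : H →* G₁) (f₂ : H →* G₂) (a : G₁ →* P) (b : G₂ →* P) (hab : a.comp f₁ = b.comp f₂) :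
    ∃ σ : AmalgamatedProduct f₁ f₂ →* P, (∀ g, σ (AmalgamatedProduct.inl f₁ f₂ g) = a g) ∧
      ∀ g, σ (AmalgamatedProduct.inr f₁ f₂ g) = b g := by
  refine ⟨QuotientGroup.lift _ (Monoid.Coprod.lift a b) ?_, fun g => rfl, fun g => rfl⟩
  apply Subgroup.normalClosure_le_normal
  rintro _ ⟨h, rfl⟩
  have := DFunLike.congr_fun hab h
  simp only [MonoidHom.comp_apply] at this
  simp [MonoidHom.mem_ker, this]

theorem amalg_gen {m n : ℕ} {H : Type*} [Group H]
    (f₁ : H →* FreeGroup (Fin m)) (f₂ : H →* FreeGroup (Fin n)) :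
    Subgroup.closure (Set.range (Sum.elim
      (fun i => AmalgamatedProduct.inl f₁ f₂ (FreeGroup.of i))
      (fun i => AmalgamatedProduct.inr f₁ f₂ (FreeGroup.of i)))) = ⊤ := by
  rw [eq_top_iff, ← amalg_closure f₁ f₂, Subgroup.closure_le, Set.Sum.elim_range]
  have h1 := congrArg (Subgroup.map (AmalgamatedProduct.inl f₁ f₂))
    (FreeGroup.closure_range_of (Fin m))
  have h2 := congrArg (Subgroup.map (AmalgamatedProduct.inr f₁ f₂))
    (FreeGroup.closure_range_of (Fin n))
  rw [MonoidHom.map_closure, ← Set.range_comp, ← MonoidHom.range_eq_map] at h1 h2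
  rw [Subgroup.closure_union]
  rintro x (hx | hx)
  · refine Subgroup.mem_sup_left ?_
    exact h1.ge hx
  · refine Subgroup.mem_sup_right ?_
    exact h2.ge hx

theorem amalg_lower {m n : ℕ} {H : Type*} [Group H]
    (f₁ : H →* FreeGroup (Fin m)) (f₂ : H →* FreeGroup (Fin n))
    (U : Subgroup (AmalgamatedProduct f₁ f₂)) (p : ℕ) (hp : p ≠ 0) (hU : U.index = p)
    (hH : Subsingleton H ∨ Nonempty (H ≃* Multiplicative ℤ)) :
    ((m + n) * p + 1 ≤ rkQ U + p + p) ∧ (Subsingleton H → (m + n) * p + 1 ≤ rkQ U + p) := by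
  have : Finite (AmalgamatedProduct f₁ f₂ ⧸ U) := by
    apply Nat.finite_of_card_ne_zero
    rw [← Subgroup.index, hU]; exact hp
  have hX : Nat.card (AmalgamatedProduct f₁ f₂ ⧸ U) = p := hU
  have : Group.FG (AmalgamatedProduct f₁ f₂) := by
    rw [Group.fg_iff]
    exact ⟨_, amalg_gen f₁ f₂, Set.finite_range _⟩
  obtain ⟨hfin, hle⟩ := Coc_le U
  set X := AmalgamatedProduct f₁ f₂ ⧸ U
  set π := MulAction.toPermHom (AmalgamatedProduct f₁ f₂) X
  have hle' : Module.finrank ℚ (Coc π) + 1 ≤ rkQ U + p := by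
    rw [← hX]; exact hle
  clear hle
  obtain ⟨hf1, hd1⟩ := Coc.finite_free m (π.comp (AmalgamatedProduct.inl f₁ f₂))
  obtain ⟨hf2, hd2⟩ := Coc.finite_free n (π.comp (AmalgamatedProduct.inr f₁ f₂))
  let C1 := Coc (π.comp (AmalgamatedProduct.inl f₁ f₂))
  let C2 := Coc (π.comp (AmalgamatedProduct.inr f₁ f₂))
  have key : ∀ T : Submodule ℚ (C1 × C2),
      (∀ c ∈ T, (Coc.perm c.1).comp f₁ = (Coc.perm c.2).comp f₂) →
      Module.finrank ℚ T ≤ Module.finrank ℚ (Coc π) := by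
    intro T hT
    let Φ : Coc π →ₗ[ℚ] C1 × C2 := (Coc.comap _ π).prod (Coc.comap _ π)
    have hr : T ≤ LinearMap.range Φ := by
      rintro ⟨c1, c2⟩ hc
      obtain ⟨σ, hσ1, hσ2⟩ := amalg_lift f₁ f₂ _ _ (hT _ hc)
      obtain ⟨c, hc⟩ := Coc_of_perm π σ _ (amalg_closure f₁ f₂) (by
        rintro _ (⟨g, rfl⟩ | ⟨g, rfl⟩)
        · exact ⟨c1.1 g, fun x q => by rw [hσ1]; rfl⟩
        · exact ⟨c2.1 g, fun x q => by rw [hσ2]; rfl⟩)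
      refine ⟨c, Prod.ext ?_ ?_⟩
      · ext g x
        have := hc (AmalgamatedProduct.inl f₁ f₂ g) x 0
        rw [hσ1] at this
        have := congrArg Prod.snd this
        simp [Coc.perm] at this
        exact this.symm
      · ext g x
        have := hc (AmalgamatedProduct.inr f₁ f₂ g) x 0
        rw [hσ2] at this
        have := congrArg Prod.snd this
        simp [Coc.perm] at this
        exact this.symm
    exact (Submodule.finrank_mono hr).trans (LinearMap.finrank_range_le Φ)
  have htot : Module.finrank ℚ (C1 × C2) = (m + n) * p := by
    rw [Module.finrank_prod, hd1, hd2, hX]; ring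
  have part2 : Subsingleton H → (m + n) * p + 1 ≤ rkQ U + p := by
    intro hs
    have := key ⊤ (by
      intro c _
      ext1 h
      rw [Subsingleton.elim h 1, map_one, map_one])
    rw [finrank_top, htot] at this
    omega
  refine ⟨?_, part2⟩
  rcases hH with hs | ⟨⟨e⟩⟩
  · have := part2 hs
    omega
  let t := e.symm (Multiplicative.ofAdd 1)
  let Λ : C1 × C2 →ₗ[ℚ] (X → ℚ) :=
    { toFun := fun c => c.1.1 (f₁ t) - c.2.1 (f₂ t)
      map_add' := fun a b => by
        funext x
        simp only [Prod.fst_add, Prod.snd_add, Submodule.coe_add, Pi.add_apply, Pi.sub_apply]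
        ring
      map_smul' := fun a b => by
        funext x
        simp [mul_sub] }
  have := Fintype.ofFinite X
  have h1 := LinearMap.finrank_range_add_finrank_ker Λ
  have h2 : Module.finrank ℚ (LinearMap.range Λ) ≤ p := by
    refine (Submodule.finrank_le _).trans ?_
    rw [Module.finrank_fintype_fun_eq_card, ← Nat.card_eq_fintype_card, hX]
  have h3 := key (LinearMap.ker Λ) (by
    intro c hc
    have hc' : ∀ x, c.1.1 (f₁ t) x = c.2.1 (f₂ t) x := fun x => by
      have := congrFun hc x
      exact sub_eq_zero.mp this
    have : ((Coc.perm c.1).comp f₁).comp e.symm.toMonoidHom =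
        ((Coc.perm c.2).comp f₂).comp e.symm.toMonoidHom := by
      apply MonoidHom.ext_mint
      show Coc.perm c.1 (f₁ t) = Coc.perm c.2 (f₂ t)
      apply Equiv.ext
      rintro ⟨x, q⟩
      show (π (AmalgamatedProduct.inl f₁ f₂ (f₁ t)) x, q + c.1.1 (f₁ t) x) =
        (π (AmalgamatedProduct.inr f₁ f₂ (f₂ t)) x, q + c.2.1 (f₂ t) x)
      rw [hc', amalg_rel]
    ext1 h
    have := DFunLike.congr_fun this (e h)
    simpa using this)
  rw [htot] at h1
  omega

theorem eval_inj_one {G : Type*} [Group G] {n : ℕ} (j₁ : FreeGroup (Fin 1) →* G)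
    (j₂ : FreeGroup (Fin n) →* G) (hcl : Subgroup.closure (Set.range j₁ ∪ Set.range j₂) = ⊤)
    (a : FreeGroup (Fin 1)) (b : FreeGroup (Fin n)) (ha : a ≠ 1) (hab : j₁ a = j₂ b) :
    Function.Injective (HomQ.eval fun i => j₂ (FreeGroup.of i)) := by
  rw [injective_iff_map_eq_zero]
  intro φ h
  have h2 : HomQ.comap j₂ φ = 0 := by
    apply HomQ_ext_closure _ (FreeGroup.closure_range_of (Fin n))
    rintro _ ⟨i, rfl⟩
    exact congrFun h i
  have h2' : ∀ g, φ.1 (j₂ g) = 0 := fun g => congrFun (congrArg Subtype.val h2) g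
  let E := FreeGroup.mulEquivIntOfUnique (α := Fin 1)
  have hpow : ∀ g : FreeGroup (Fin 1), φ.1 (j₁ g) =
      ((E g).toAdd : ℚ) * φ.1 (j₁ (E.symm (Multiplicative.ofAdd 1))) := by
    have : ((HomQ.toHom φ).comp j₁).comp E.symm.toMonoidHom =
      { toFun := fun k => Multiplicative.ofAdd
          ((k.toAdd : ℚ) * φ.1 (j₁ (E.symm (Multiplicative.ofAdd 1))))
        map_one' := by simp
        map_mul' := fun x y => by
          simp only [toAdd_mul, Int.cast_add, add_mul]; rfl } := by
      apply MonoidHom.ext_mint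
      simp [HomQ.toHom]
    intro g
    have := DFunLike.congr_fun this (E g)
    simpa [HomQ.toHom] using this
  have hE : ((E a).toAdd : ℚ) ≠ 0 := by
    intro h; apply ha
    apply E.injective
    rw [map_one]; exact_mod_cast h
  have h0 : φ.1 (j₁ (E.symm (Multiplicative.ofAdd 1))) = 0 := by
    have := hpow a
    rw [hab, h2'] at this
    exact (mul_eq_zero.mp this.symm).resolve_left hE
  apply HomQ_ext_closure _ hcl
  rintro _ (⟨g, rfl⟩ | ⟨g, rfl⟩)
  · rw [hpow, h0, mul_zero]
  · exact h2' g

theorem rkQ_gt_d_amalgam_free (m n p : ℕ) (hp : p.Prime) (H : Type*) [Group H]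
    (hH : Subsingleton H ∨ Nonempty (H ≃* Multiplicative ℤ))
    (f₁ : H →* FreeGroup (Fin m)) (f₂ : H →* FreeGroup (Fin n))
    (hf₁ : Function.Injective f₁) (hf₂ : Function.Injective f₂)
    (hlim : FullyResiduallyFree (AmalgamatedProduct f₁ f₂))
    (hna : ¬ ∀ a b : AmalgamatedProduct f₁ f₂, a * b = b * a)
    (U : Subgroup (AmalgamatedProduct f₁ f₂)) [U.Normal] (hU : U.index = p) :
    d (AmalgamatedProduct f₁ f₂) < rkQ ↥U ∧
      d (AmalgamatedProduct f₁ f₂) < d ↥U := by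
  have hp2 := hp.two_le
  obtain ⟨hlow, hlow'⟩ := amalg_lower f₁ f₂ U p hp.ne_zero hU hH
  have hFG : Group.FG (AmalgamatedProduct f₁ f₂) := by
    rw [Group.fg_iff]
    exact ⟨_, amalg_gen f₁ f₂, Set.finite_range _⟩
  have : U.FiniteIndex := ⟨by rw [hU]; exact hp.ne_zero⟩
  have hUd : rkQ U ≤ d U := rkQ_le_d
  have hdN : d (AmalgamatedProduct f₁ f₂) ≤ m + n := by
    simpa using d_le _ (amalg_gen f₁ f₂)
  suffices h : d (AmalgamatedProduct f₁ f₂) < rkQ U from ⟨h, h.trans_le hUd⟩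
  by_cases hs : Subsingleton H
  · have h1 := hlow' hs
    have h2 : 2 ≤ m + n := by
      have hinj := HomQ.eval_inj _ (amalg_gen f₁ f₂)
      let e := LinearEquiv.funCongrLeft ℚ ℚ (finSumFinEquiv (m := m) (n := n)).symm
      exact (limit_small hlim hna (m + n) (e.toLinearMap ∘ₗ HomQ.eval _)
        (e.injective.comp hinj)).1
    nlinarith
  · have hnt : Nontrivial H := not_subsingleton_iff_nontrivial.mp hs
    obtain ⟨t, ht⟩ := exists_ne (1 : H)
    have ht1 : f₁ t ≠ 1 := fun h => ht (hf₁ (by rw [h, map_one]))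
    have ht2 : f₂ t ≠ 1 := fun h => ht (hf₂ (by rw [h, map_one]))
    have hm : m ≠ 0 := by
      rintro rfl; exact ht1 (Subsingleton.elim _ _)
    have hn : n ≠ 0 := by
      rintro rfl; exact ht2 (Subsingleton.elim _ _)
    have hmain : 4 ≤ m + n ∨ (m + n = 3 ∧ d (AmalgamatedProduct f₁ f₂) ≤ 2) := by
      by_cases hm1 : m = 1
      · subst hm1
        have := limit_small hlim hna n _ (eval_inj_one (AmalgamatedProduct.inl f₁ f₂)
          (AmalgamatedProduct.inr f₁ f₂) (amalg_closure f₁ f₂) _ _ ht1 (amalg_rel f₁ f₂ t))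
        by_cases hn2 : n = 2
        · exact Or.inr ⟨by omega, this.2 hn2⟩
        · omega
      by_cases hn1 : n = 1
      · subst hn1
        have := limit_small hlim hna m _ (eval_inj_one (AmalgamatedProduct.inr f₁ f₂)
          (AmalgamatedProduct.inl f₁ f₂) (by rw [Set.union_comm]; exact amalg_closure f₁ f₂)
          _ _ ht2 (amalg_rel f₁ f₂ t).symm)
        by_cases hm2 : m = 2
        · exact Or.inr ⟨by omega, this.2 hm2⟩
        · omega
      omega
    rcases hmain with h4 | ⟨h3, hd⟩
    · nlinarith
    · rw [h3] at hlow
      omega
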